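/- Let G be a finite simple graph on a vertex set V with |V| = n ≥ 1, and fix an integer q ≥ 1. Let G_q be the graph on vertex set V ⊔ (V × {1,…,q}) whose edges are the edges of G together with the edges {v, (v,j)} for every v ∈ V and 1 ≤ j ≤ q (so G_q is obtained from G by attaching q pendant leaves to every vertex). Then P_{G_q}(x) = ∑_{k=0}^{α(G)} g_k(G) x^k (1+x)^{q(n−k)}; moreover α(G_q) = qn and M(G_q) = q(n − α(G)). -/

import Mathlib

attribute [local instance] Classical.propDecidable

/-- `s` is an independent set of vertices of `G`. -/
def IsIndep {V : Type*} (G : SimpleGraph V) (s : Finset V) : Prop :=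
  ∀ v ∈ s, ∀ w ∈ s, ¬ G.Adj v w

/-- The independence polynomial `P_G(x) = ∑ g_i x^i`. -/
noncomputable def indepPoly {V : Type*} [Fintype V] (G : SimpleGraph V) : Polynomial ℤ :=
  ∑ s ∈ Finset.univ.filter (fun s : Finset V => IsIndep G s), Polynomial.X ^ s.card

/-- `g_i(G)`: the number of independent sets of `G` of cardinality `i`. -/
noncomputable def gCount {V : Type*} [Fintype V] (G : SimpleGraph V) (i : ℕ) : ℕ :=
  (Finset.univ.filter (fun s : Finset V => IsIndep G s ∧ s.card = i)).card

/-- The independence number `α(G)`. -/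
noncomputable def indepNum {V : Type*} [Fintype V] (G : SimpleGraph V) : ℕ :=
  (Finset.univ.filter (fun s : Finset V => IsIndep G s)).sup Finset.card

/-- `M(G)`: the multiplicity of `x = -1` as a root of `P_G(x)`. -/
noncomputable def multM {V : Type*} [Fintype V] (G : SimpleGraph V) : ℕ :=
  (indepPoly G).rootMultiplicity (-1)

/-- The defining relation of the uniform `q`-whiskering of `G`: the edges of `G` together
with the pendant edges `{v, (v, j)}` for each vertex `v` and each `j < q`. -/
def WRel {V : Type*} (G : SimpleGraph V) (q : ℕ) :
    (V ⊕ V × Fin q) → (V ⊕ V × Fin q) → Prop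
  | Sum.inl a, Sum.inl b => G.Adj a b
  | Sum.inl a, Sum.inr (b, _) => a = b
  | _, _ => False

/-- The uniform `q`-whiskering `G_q` of `G` (attach `q` pendant leaves to every vertex). -/
noncomputable def whiskerAll {V : Type*} (G : SimpleGraph V) (q : ℕ) :
    SimpleGraph (V ⊕ V × Fin q) :=
  SimpleGraph.fromRel (WRel G q)

/-- The leaves of `G_q` that are not attached to a vertex of `s`. -/
noncomputable def freeLeaves {V : Type*} [Fintype V] (q : ℕ) (s : Finset V) :
    Finset (V × Fin q) :=
  sᶜ ×ˢ Finset.univ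

theorem card_freeLeaves {V : Type*} [Fintype V] (q : ℕ) (s : Finset V) :
    (freeLeaves q s).card = q * (Fintype.card V - s.card) := by
  rw [freeLeaves, Finset.card_product, Finset.card_compl, Finset.card_univ, Fintype.card_fin,
    mul_comm]

theorem isIndep_whiskerAll_iff {V : Type*} [Fintype V] (G : SimpleGraph V) (q : ℕ)
    (u : Finset (V ⊕ V × Fin q)) :
    IsIndep (whiskerAll G q) u ↔
      IsIndep G u.toLeft ∧ u.toRight ⊆ freeLeaves q u.toLeft := by
  constructor
  · intro h
    refine ⟨fun v hv w hw hvw ↦ ?_, fun p hp ↦ ?_⟩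
    · refine h _ (Finset.mem_toLeft.1 hv) _ (Finset.mem_toLeft.1 hw) ?_
      exact (SimpleGraph.fromRel_adj _ _ _).2
        ⟨fun e ↦ hvw.ne (Sum.inl_injective e), Or.inl hvw⟩
    · simp only [freeLeaves, Finset.mem_product, Finset.mem_compl, Finset.mem_univ, and_true]
      intro hl
      refine h _ (Finset.mem_toLeft.1 hl) _ (Finset.mem_toRight.1 hp) ?_
      exact (SimpleGraph.fromRel_adj _ _ _).2 ⟨Sum.inl_ne_inr, Or.inl rfl⟩
  · rintro ⟨hl, hr⟩ x hx y hy hxy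
    have key : ∀ v (p : V × Fin q), Sum.inl v ∈ u → Sum.inr p ∈ u → v ≠ p.1 := by
      rintro v p hv hp rfl
      have := hr (Finset.mem_toRight.2 hp)
      simp only [freeLeaves, Finset.mem_product, Finset.mem_compl] at this
      exact this.1 (Finset.mem_toLeft.2 hv)
    obtain ⟨-, hxy⟩ := (SimpleGraph.fromRel_adj _ _ _).1 hxy
    rcases x with a | a <;> rcases y with b | b
    · have hab : G.Adj a b := hxy.elim id fun h ↦ SimpleGraph.Adj.symm h
      exact hl _ (Finset.mem_toLeft.2 hx) _ (Finset.mem_toLeft.2 hy) hab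
    · exact hxy.elim (key a b hx hy) id
    · exact hxy.elim id (key b a hy hx)
    · exact hxy.elim id id

theorem indepPoly_whiskerAll {V : Type*} [Fintype V] (G : SimpleGraph V) (q : ℕ) :
    indepPoly (whiskerAll G q) =
      ∑ s ∈ Finset.univ.filter (fun s : Finset V => IsIndep G s),
        Polynomial.X ^ s.card * (1 + Polynomial.X) ^ (q * (Fintype.card V - s.card)) := by
  have expand (s : Finset V) :
      (1 + Polynomial.X : Polynomial ℤ) ^ (q * (Fintype.card V - s.card)) =
        ∑ t ∈ (freeLeaves q s).powerset, Polynomial.X ^ t.card := by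
    rw [← card_freeLeaves, add_comm, ← Finset.sum_pow_mul_eq_add_pow]
    simp
  simp_rw [expand, Finset.mul_sum, ← pow_add]
  rw [indepPoly, Finset.sum_sigma']
  refine Finset.sum_bij' (fun u _ ↦ ⟨u.toLeft, u.toRight⟩) (fun p _ ↦ p.1.disjSum p.2)
    ?_ ?_ ?_ ?_ ?_
  · intro u hu
    simpa [isIndep_whiskerAll_iff] using hu
  · intro p hp
    simpa [isIndep_whiskerAll_iff] using hp
  · intro u _
    exact Finset.toLeft_disjSum_toRight
  · intro p _
    simp
  · intro u _
    rw [Finset.card_toLeft_add_card_toRight]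

theorem IsIndep.card_le_indepNum {V : Type*} [Fintype V] {G : SimpleGraph V} {s : Finset V}
    (hs : IsIndep G s) : s.card ≤ indepNum G :=
  Finset.le_sup (f := Finset.card) (by simpa using hs)

theorem exists_isIndep_card_eq_indepNum {V : Type*} [Fintype V] (G : SimpleGraph V) :
    ∃ s : Finset V, IsIndep G s ∧ s.card = indepNum G := by
  have hne : (Finset.univ.filter (fun s : Finset V => IsIndep G s)).Nonempty :=
    ⟨∅, Finset.mem_filter.2 ⟨Finset.mem_univ _,
      fun v hv ↦ absurd hv (Finset.notMem_empty v)⟩⟩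
  obtain ⟨s, hs, h⟩ := Finset.exists_mem_eq_sup _ hne Finset.card
  exact ⟨s, by simpa using hs, h.symm⟩

theorem indepNum_le_card {V : Type*} [Fintype V] (G : SimpleGraph V) :
    indepNum G ≤ Fintype.card V :=
  Finset.sup_le fun s _ ↦ s.card_le_univ

theorem gCount_indepNum_ne_zero {V : Type*} [Fintype V] (G : SimpleGraph V) :
    gCount G (indepNum G) ≠ 0 := by
  obtain ⟨s, hs⟩ := exists_isIndep_card_eq_indepNum G
  exact Finset.card_ne_zero_of_mem (a := s) (by simpa using hs)

theorem sum_isIndep_card {V R : Type*} [Fintype V] [Semiring R] (G : SimpleGraph V) (f : ℕ → R) :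
    ∑ s ∈ Finset.univ.filter (fun s : Finset V => IsIndep G s), f s.card =
      ∑ k ∈ Finset.range (indepNum G + 1), (gCount G k : R) * f k := by
  rw [← Finset.sum_fiberwise_of_maps_to (g := Finset.card) (t := Finset.range (indepNum G + 1))]
  · refine Finset.sum_congr rfl fun k _ ↦ ?_
    rw [Finset.sum_congr rfl fun s hs ↦ by rw [(Finset.mem_filter.1 hs).2], Finset.sum_const,
      nsmul_eq_mul, Finset.filter_filter, gCount]
  · intro s hs
    exact Finset.mem_range_succ_iff.2 (IsIndep.card_le_indepNum (Finset.mem_filter.1 hs).2)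

theorem indepNum_whiskerAll {V : Type*} [Fintype V] (G : SimpleGraph V) {q : ℕ} (hq : 1 ≤ q) :
    indepNum (whiskerAll G q) = q * Fintype.card V := by
  apply le_antisymm
  · refine Finset.sup_le fun u hu ↦ ?_
    have hr := Finset.card_le_card
      ((isIndep_whiskerAll_iff G q u).1 (Finset.mem_filter.1 hu).2).2
    rw [card_freeLeaves] at hr
    have hV := u.toLeft.card_le_univ
    calc u.card = u.toLeft.card + u.toRight.card := Finset.card_toLeft_add_card_toRight.symm
      _ ≤ q * u.toLeft.card + q * (Fintype.card V - u.toLeft.card) :=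
        add_le_add (Nat.le_mul_of_pos_left _ hq) hr
      _ = q * Fintype.card V := by rw [← mul_add, Nat.add_sub_cancel' hV]
  · have h : IsIndep (whiskerAll G q) ((∅ : Finset V).disjSum Finset.univ) := by
      rw [isIndep_whiskerAll_iff, Finset.toLeft_disjSum, Finset.toRight_disjSum]
      exact ⟨fun v hv ↦ absurd hv (Finset.notMem_empty v), fun p _ ↦ by simp [freeLeaves]⟩
    simpa [mul_comm] using h.card_le_indepNum

/-- If `c m` is nonzero, then `-1` is a root of multiplicity `q * (n - m)` of
`∑ k ≤ m, c k * x ^ k * (1 + x) ^ (q * (n - k))`. -/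
theorem rootMultiplicity_sum_mul_one_add_X_pow {q m n : ℕ} (hq : 1 ≤ q) (hmn : m ≤ n)
    (c : ℕ → ℤ) (hc : c m ≠ 0) :
    (∑ k ∈ Finset.range (m + 1), Polynomial.C (c k) * Polynomial.X ^ k
      * (1 + Polynomial.X) ^ (q * (n - k))).rootMultiplicity (-1) = q * (n - m) := by
  let Q : Polynomial ℤ := ∑ k ∈ Finset.range (m + 1), Polynomial.C (c k) * Polynomial.X ^ k
    * (1 + Polynomial.X) ^ (q * (m - k))
  have hQ : Q.eval (-1) ≠ 0 := by
    have : Q.eval (-1) = c m * (-1) ^ m := by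
      simp only [Q, Polynomial.eval_finsetSum]
      rw [Finset.sum_range_succ, Finset.sum_eq_zero]
      · simp
      · intro k hk
        have : q * (m - k) ≠ 0 :=
          mul_ne_zero (by omega) (Nat.sub_ne_zero_of_lt (Finset.mem_range.1 hk))
        simp [this]
    rw [this]
    exact mul_ne_zero hc (pow_ne_zero _ (by norm_num))
  have hfac : (∑ k ∈ Finset.range (m + 1), Polynomial.C (c k) * Polynomial.X ^ k
      * (1 + Polynomial.X) ^ (q * (n - k))) =
        Q * (Polynomial.X - Polynomial.C (-1)) ^ (q * (n - m)) := by
    have hX : (Polynomial.X - Polynomial.C (-1) : Polynomial ℤ) = 1 + Polynomial.X := by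
      simp [add_comm]
    rw [hX, Finset.sum_mul]
    refine Finset.sum_congr rfl fun k hk ↦ ?_
    have hk := Finset.mem_range_succ_iff.1 hk
    rw [mul_assoc (_ * _) (_ ^ _) (_ ^ _), ← pow_add, ← mul_add]
    congr 3
    omega
  have hQ0 : Q ≠ 0 := fun h ↦ hQ (by simp [h])
  rw [hfac, Polynomial.rootMultiplicity_mul_X_sub_C_pow hQ0,
    Polynomial.rootMultiplicity_eq_zero hQ, zero_add]

/-- For the uniform `q`-whiskering `G_q` on `n = |V|` vertices:
`P_{G_q}(x) = ∑_{k=0}^{α(G)} g_k(G) x^k (1+x)^{q(n-k)}`, `α(G_q) = q n`, and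
`M(G_q) = q (n - α(G))`. -/
theorem whiskerAll_invariants {V : Type*} [Fintype V] (G : SimpleGraph V)
    (q : ℕ) (hq : 1 ≤ q) (hn : 1 ≤ Fintype.card V) :
    indepPoly (whiskerAll G q)
        = ∑ k ∈ Finset.range (indepNum G + 1),
            Polynomial.C ((gCount G k : ℤ)) * Polynomial.X ^ k
              * (1 + Polynomial.X) ^ (q * (Fintype.card V - k))
      ∧ indepNum (whiskerAll G q) = q * Fintype.card V
      ∧ multM (whiskerAll G q) = q * (Fintype.card V - indepNum G) := by
  have hP : indepPoly (whiskerAll G q) = _ :=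
    (indepPoly_whiskerAll G q).trans (sum_isIndep_card G fun k ↦
      Polynomial.X ^ k * (1 + Polynomial.X) ^ (q * (Fintype.card V - k)))
  simp only [← mul_assoc] at hP
  have hP' : indepPoly (whiskerAll G q) =
      ∑ k ∈ Finset.range (indepNum G + 1), Polynomial.C ((gCount G k : ℤ)) * Polynomial.X ^ k
        * (1 + Polynomial.X) ^ (q * (Fintype.card V - k)) := by
    simpa using hP
  refine ⟨hP', indepNum_whiskerAll G hq, ?_⟩
  rw [multM, hP']
  exact rootMultiplicity_sum_mul_one_add_X_pow hq (indepNum_le_card G) (fun k ↦ (gCount G k : ℤ))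
    (by exact_mod_cast gCount_indepNum_ne_zero G)
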